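/- arXiv:2104.11923 — 2 statements merged into one kernel-verified Lean document; each statement's English description precedes it below -/
import Mathlib

section
/- Fix α ∈ ℝ. The map X ↦ [X]_α is concave on positive semidefinite matrices with respect to the Loewner order on operators on the Hilbert space (M_n(ℂ), ⟨·,·⟩): for all positive semidefinite X, Y ∈ M_n(ℂ) and t ∈ [0,1], [tX + (1−t)Y]_α ≥ t[X]_α + (1−t)[Y]_α. -/
open MeasureTheory Matrix
open scoped ENNReal Classical ComplexOrder

/-- Normalized trace `τ(A) = Tr(A)/n` on `M_n(ℂ)`. -/
noncomputable def tau {N : Type*} [Fintype N] (A : Matrix N N ℂ) : ℂ :=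
  A.trace / (Fintype.card N)

/-- GNS inner product `⟨A,B⟩ = τ(A* B)`, conjugate-linear in the first argument. -/
noncomputable def gns {N : Type*} [Fintype N] (A B : Matrix N N ℂ) : ℂ := tau (Aᴴ * B)

/-- Fractional power `X^s` of a positive semidefinite matrix via functional calculus
(junk value `0` if `X` is not hermitian). -/
noncomputable def mpow {N : Type*} [Fintype N] [DecidableEq N] (X : Matrix N N ℂ) (s : ℝ) :
    Matrix N N ℂ :=
  if hX : X.IsHermitian then
    (Matrix.IsHermitian.eigenvectorUnitary hX : Matrix N N ℂ) *
      Matrix.diagonal (fun i => ((hX.eigenvalues i ^ s : ℝ) : ℂ)) *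
      (star (Matrix.IsHermitian.eigenvectorUnitary hX : Matrix N N ℂ))
  else 0

/-- The operator `[X]_α(A) = ∫₀¹ e^{α(s-1/2)} X^s A X^{1-s} ds` on `M_n(ℂ)`. -/
noncomputable def sandwich {N : Type*} [Fintype N] [DecidableEq N] (X : Matrix N N ℂ) (α : ℝ)
    (A : Matrix N N ℂ) : Matrix N N ℂ :=
  Matrix.of fun i k =>
    ∫ s in (0:ℝ)..1, Real.exp (α * (s - 1/2)) • ((mpow X s * A * mpow X (1 - s)) i k)

/-- `T` is a positive semidefinite (self-adjoint) operator on the Hilbert space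
`(M_n(ℂ), ⟨·,·⟩)` with the GNS inner product. -/
def OpPosSemidef {N : Type*} [Fintype N] (T : Matrix N N ℂ → Matrix N N ℂ) : Prop :=
  (∀ A B : Matrix N N ℂ, gns (T A) B = gns A (T B)) ∧
  ∀ A : Matrix N N ℂ, 0 ≤ (gns A (T A)).re

/-- The matrix of `A` in the eigenbasis of the hermitian matrix `X`. -/
noncomputable def eigenConj {N : Type*} [Fintype N] [DecidableEq N] {X : Matrix N N ℂ}
    (hX : X.IsHermitian) (A : Matrix N N ℂ) : Matrix N N ℂ :=
  star (hX.eigenvectorUnitary : Matrix N N ℂ) * A * (hX.eigenvectorUnitary : Matrix N N ℂ)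

/-- The quadratic form of the operator `k(L_X, R_X)`, written in the eigenbasis of `X`. -/
noncomputable def kernelQuad {N : Type*} [Fintype N] [DecidableEq N] {X : Matrix N N ℂ}
    (hX : X.IsHermitian) (k : ℝ → ℝ → ℝ) (A : Matrix N N ℂ) : ℝ :=
  ∑ i, ∑ j, k (hX.eigenvalues i) (hX.eigenvalues j) * Complex.normSq (eigenConj hX A i j)

/-- The kernel `k` is operator concave: `X ↦ k(L_X, R_X)` is concave on positive semidefinite
matrices indexed by `N`. -/
def ConcaveKernel (N : Type*) [Fintype N] [DecidableEq N] (k : ℝ → ℝ → ℝ) : Prop :=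
  ∀ (X Y Z : Matrix N N ℂ) (hX : X.PosSemidef) (hY : Y.PosSemidef) (hZ : Z.PosSemidef)
    (t : ℝ), 0 ≤ t → t ≤ 1 → Z = t • X + (1 - t) • Y → ∀ A : Matrix N N ℂ,
    t * kernelQuad hX.1 k A + (1 - t) * kernelQuad hY.1 k A ≤ kernelQuad hZ.1 k A

lemma trace_conjTranspose_mul_eq_sum {N : Type*} [Fintype N] (A B : Matrix N N ℂ) :
    (Aᴴ * B).trace = ∑ i, ∑ j, star (A i j) * B i j := by
  simp only [Matrix.trace, Matrix.diag_apply, Matrix.mul_apply, Matrix.conjTranspose_apply]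
  exact Finset.sum_comm

section Eigenbasis

variable {N : Type*} [Fintype N] [DecidableEq N] {X : Matrix N N ℂ}

lemma eigenvectorUnitary_mul_star (hX : X.IsHermitian) :
    (hX.eigenvectorUnitary : Matrix N N ℂ) * star (hX.eigenvectorUnitary : Matrix N N ℂ) = 1 :=
  Unitary.coe_mul_star_self hX.eigenvectorUnitary

lemma eigenvectorUnitary_mul_eigenConj_mul_star (hX : X.IsHermitian) (A : Matrix N N ℂ) :
    (hX.eigenvectorUnitary : Matrix N N ℂ) * eigenConj hX A *
      star (hX.eigenvectorUnitary : Matrix N N ℂ) = A := by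
  have h := eigenvectorUnitary_mul_star hX
  simp only [eigenConj, Matrix.mul_assoc, h, mul_one]
  rw [← Matrix.mul_assoc, h, one_mul]

lemma eigenConj_mul_mul_star (hX : X.IsHermitian) (M : Matrix N N ℂ) :
    eigenConj hX ((hX.eigenvectorUnitary : Matrix N N ℂ) * M *
      star (hX.eigenvectorUnitary : Matrix N N ℂ)) = M := by
  have h := Unitary.coe_star_mul_self hX.eigenvectorUnitary
  simp only [eigenConj, Matrix.mul_assoc, h, mul_one]
  rw [← Matrix.mul_assoc, h, one_mul]

lemma eigenConj_mul (hX : X.IsHermitian) (A B : Matrix N N ℂ) :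
    eigenConj hX (A * B) = eigenConj hX A * eigenConj hX B := by
  have h := eigenvectorUnitary_mul_star hX
  simp only [eigenConj, Matrix.mul_assoc]
  rw [← Matrix.mul_assoc _ (star _) (B * _), h, one_mul]

lemma eigenConj_conjTranspose (hX : X.IsHermitian) (A : Matrix N N ℂ) :
    eigenConj hX Aᴴ = (eigenConj hX A)ᴴ := by
  simp [eigenConj, Matrix.star_eq_conjTranspose, Matrix.conjTranspose_mul, Matrix.mul_assoc]

lemma eigenConj_sub (hX : X.IsHermitian) (A B : Matrix N N ℂ) :
    eigenConj hX (A - B) = eigenConj hX A - eigenConj hX B := by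
  simp [eigenConj, mul_sub, sub_mul]

lemma trace_eigenConj (hX : X.IsHermitian) (A : Matrix N N ℂ) :
    (eigenConj hX A).trace = A.trace := by
  rw [eigenConj, Matrix.trace_mul_comm, ← Matrix.mul_assoc,
    eigenvectorUnitary_mul_star, one_mul]

lemma eigenConj_self (hX : X.IsHermitian) :
    eigenConj hX X = Matrix.diagonal (fun i => (hX.eigenvalues i : ℂ)) := by
  have h : X = (hX.eigenvectorUnitary : Matrix N N ℂ) *
      Matrix.diagonal (fun i => (hX.eigenvalues i : ℂ)) *
      star (hX.eigenvectorUnitary : Matrix N N ℂ) := by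
    conv_lhs => rw [hX.spectral_theorem]
    simp [Unitary.conjStarAlgAut_apply, Function.comp_def]
  exact (congrArg (eigenConj hX) h).trans (eigenConj_mul_mul_star hX _)

lemma eigenConj_mpow (hX : X.IsHermitian) (s : ℝ) :
    eigenConj hX (mpow X s) =
      Matrix.diagonal (fun i => ((hX.eigenvalues i ^ s : ℝ) : ℂ)) := by
  rw [mpow, dif_pos hX, eigenConj_mul_mul_star]

lemma gns_eq_sum_eigenConj (hX : X.IsHermitian) (A B : Matrix N N ℂ) :
    gns A B = (∑ i, ∑ j, star (eigenConj hX A i j) * eigenConj hX B i j) / Fintype.card N := by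
  rw [gns, tau, ← trace_eigenConj hX, eigenConj_mul, eigenConj_conjTranspose,
    trace_conjTranspose_mul_eq_sum]

lemma kernelQuad_left (hX : X.IsHermitian) (A : Matrix N N ℂ) :
    kernelQuad hX (fun x _ => x) A = (Aᴴ * (X * A)).trace.re := by
  rw [← trace_eigenConj hX, eigenConj_mul, eigenConj_mul, eigenConj_conjTranspose,
    trace_conjTranspose_mul_eq_sum, eigenConj_self, kernelQuad]
  simp only [Complex.re_sum, Matrix.diagonal_mul]
  refine Finset.sum_congr rfl fun i _ => Finset.sum_congr rfl fun j _ => ?_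
  simp [Complex.normSq_apply]
  ring

lemma kernelQuad_right (hX : X.IsHermitian) (A : Matrix N N ℂ) :
    kernelQuad hX (fun _ y => y) A = (Aᴴ * (A * X)).trace.re := by
  rw [← trace_eigenConj hX, eigenConj_mul, eigenConj_mul, eigenConj_conjTranspose,
    trace_conjTranspose_mul_eq_sum, eigenConj_self, kernelQuad]
  simp only [Complex.re_sum, Matrix.mul_diagonal]
  refine Finset.sum_congr rfl fun i _ => Finset.sum_congr rfl fun j _ => ?_
  simp [Complex.normSq_apply]
  ring

lemma kernelQuad_integral {Ω : Type*} [MeasurableSpace Ω] {μ : Measure Ω} (hX : X.PosSemidef)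
    {κ : Ω → ℝ → ℝ → ℝ} (hκ : ∀ x y, 0 ≤ x → 0 ≤ y → Integrable (fun ω => κ ω x y) μ)
    (A : Matrix N N ℂ) :
    Integrable (fun ω => kernelQuad hX.1 (κ ω) A) μ ∧
      ∫ ω, kernelQuad hX.1 (κ ω) A ∂μ =
        kernelQuad hX.1 (fun x y => ∫ ω, κ ω x y ∂μ) A := by
  have h (i j : N) : Integrable (fun ω => κ ω (hX.1.eigenvalues i) (hX.1.eigenvalues j) *
      Complex.normSq (eigenConj hX.1 A i j)) μ :=
    (hκ _ _ (hX.eigenvalues_nonneg i) (hX.eigenvalues_nonneg j)).mul_const _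
  unfold kernelQuad
  refine ⟨integrable_finsetSum _ fun i _ => integrable_finsetSum _ fun j _ => h i j, ?_⟩
  rw [integral_finsetSum _ fun i _ => integrable_finsetSum _ fun j _ => h i j]
  refine Finset.sum_congr rfl fun i _ => ?_
  rw [integral_finsetSum _ fun j _ => h i j]
  exact Finset.sum_congr rfl fun j _ => integral_mul_const _ _

end Eigenbasis

section ConcaveKernel

variable {N : Type*} [Fintype N] [DecidableEq N]

lemma ConcaveKernel.congr {k l : ℝ → ℝ → ℝ} (hk : ConcaveKernel N k)
    (h : ∀ x y, 0 ≤ x → 0 ≤ y → l x y = k x y) : ConcaveKernel N l := by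
  intro X Y Z hX hY hZ t ht0 ht1 hZe A
  have key {W : Matrix N N ℂ} (hW : W.PosSemidef) : kernelQuad hW.1 l A = kernelQuad hW.1 k A :=
    Finset.sum_congr rfl fun i _ => Finset.sum_congr rfl fun j _ => by
      rw [h _ _ (hW.eigenvalues_nonneg i) (hW.eigenvalues_nonneg j)]
  rw [key hX, key hY, key hZ]
  exact hk X Y Z hX hY hZ t ht0 ht1 hZe A

lemma ConcaveKernel.const_mul {k : ℝ → ℝ → ℝ} (hk : ConcaveKernel N k) {c : ℝ} (hc : 0 ≤ c) :
    ConcaveKernel N (fun x y => c * k x y) := by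
  intro X Y Z hX hY hZ t ht0 ht1 hZe A
  have key {W : Matrix N N ℂ} (hW : W.IsHermitian) :
      kernelQuad hW (fun x y => c * k x y) A = c * kernelQuad hW k A := by
    simp only [kernelQuad, Finset.mul_sum, mul_assoc]
  rw [key, key, key]
  linarith [mul_le_mul_of_nonneg_left (hk X Y Z hX hY hZ t ht0 ht1 hZe A) hc]

lemma ConcaveKernel.integral {Ω : Type*} [MeasurableSpace Ω] {μ : Measure Ω}
    {κ : Ω → ℝ → ℝ → ℝ} (hc : ∀ᵐ ω ∂μ, ConcaveKernel N (κ ω))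
    (hκ : ∀ x y, 0 ≤ x → 0 ≤ y → Integrable (fun ω => κ ω x y) μ) :
    ConcaveKernel N (fun x y => ∫ ω, κ ω x y ∂μ) := by
  intro X Y Z hX hY hZ t ht0 ht1 hZe A
  obtain ⟨iX, eX⟩ := kernelQuad_integral hX hκ A
  obtain ⟨iY, eY⟩ := kernelQuad_integral hY hκ A
  obtain ⟨iZ, eZ⟩ := kernelQuad_integral hZ hκ A
  rw [← eX, ← eY, ← eZ, ← integral_const_mul, ← integral_const_mul,
    ← integral_add (iX.const_mul _) (iY.const_mul _)]
  refine integral_mono_ae ((iX.const_mul _).add (iY.const_mul _)) iZ ?_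
  filter_upwards [hc] with ω hω
  exact hω X Y Z hX hY hZ t ht0 ht1 hZe A

/-- The upper bound for the parallel sum of `x / r` and `y` given by the splitting
`a = b + (a - b)`. -/
lemma parallelSum_mul_normSq_le {r x y : ℝ} (hr : 0 < r) (hx : 0 ≤ x) (hy : 0 ≤ y) (a b : ℂ) :
    x * y / (x + r * y) * Complex.normSq a ≤
      r⁻¹ * (x * Complex.normSq b) + y * Complex.normSq (a - b) := by
  rcases (add_nonneg hx (mul_nonneg hr.le hy)).eq_or_lt with h | h
  · rw [← h]
    simp only [div_zero, zero_mul]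
    have := Complex.normSq_nonneg b
    have := Complex.normSq_nonneg (a - b)
    positivity
  · rw [div_mul_eq_mul_div, div_le_iff₀ h, inv_mul_eq_div, div_add' _ _ _ hr.ne',
      div_mul_eq_mul_div, le_div_iff₀ hr]
    simp only [Complex.normSq_apply, Complex.sub_re, Complex.sub_im]
    nlinarith [sq_nonneg (x * b.re - r * y * (a.re - b.re)),
      sq_nonneg (x * b.im - r * y * (a.im - b.im))]

lemma parallelSum_mul_normSq_eq {r x y : ℝ} (hr : 0 < r) (hx : 0 ≤ x) (hy : 0 ≤ y) (a : ℂ) :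
    x * y / (x + r * y) * Complex.normSq a =
      r⁻¹ * (x * Complex.normSq (((r * y / (x + r * y) : ℝ) : ℂ) * a)) +
        y * Complex.normSq (a - ((r * y / (x + r * y) : ℝ) : ℂ) * a) := by
  rcases (add_nonneg hx (mul_nonneg hr.le hy)).eq_or_lt with h | h
  · have hx0 : x = 0 := by nlinarith [mul_nonneg hr.le hy]
    have hy0 : y = 0 := by
      have : r * y = 0 := by linarith
      exact (mul_eq_zero.1 this).resolve_left hr.ne'
    simp [hx0, hy0]
  · have e : a - ((r * y / (x + r * y) : ℝ) : ℂ) * a = ((x / (x + r * y) : ℝ) : ℂ) * a := by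
      have : (x / (x + r * y) : ℝ) = 1 - r * y / (x + r * y) := by field_simp; ring
      rw [this]; push_cast; ring
    rw [e, Complex.normSq_mul, Complex.normSq_mul, Complex.normSq_ofReal, Complex.normSq_ofReal]
    obtain ⟨d, hd⟩ : ∃ d, d = x + r * y := ⟨_, rfl⟩
    rw [← hd] at h ⊢
    field_simp
    rw [hd]
    ring

lemma concaveKernel_parallelSum {r : ℝ} (hr : 0 < r) :
    ConcaveKernel N (fun x y => x * y / (x + r * y)) := by
  intro X Y Z hX hY hZ t ht0 ht1 hZe A
  have upper {W : Matrix N N ℂ} (hW : W.PosSemidef) (B : Matrix N N ℂ) :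
      kernelQuad hW.1 (fun x y => x * y / (x + r * y)) A ≤
        r⁻¹ * (Bᴴ * (W * B)).trace.re + ((A - B)ᴴ * ((A - B) * W)).trace.re := by
    rw [← kernelQuad_left hW.1, ← kernelQuad_right hW.1]
    simp only [kernelQuad, Finset.mul_sum, ← Finset.sum_add_distrib, eigenConj_sub]
    exact Finset.sum_le_sum fun i _ => Finset.sum_le_sum fun j _ =>
      parallelSum_mul_normSq_le hr (hW.eigenvalues_nonneg i) (hW.eigenvalues_nonneg j) _ _
  obtain ⟨B, hB⟩ : ∃ B : Matrix N N ℂ,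
      kernelQuad hZ.1 (fun x y => x * y / (x + r * y)) A =
        r⁻¹ * (Bᴴ * (Z * B)).trace.re + ((A - B)ᴴ * ((A - B) * Z)).trace.re := by
    let M : Matrix N N ℂ := Matrix.of fun i j =>
      ((r * hZ.1.eigenvalues j / (hZ.1.eigenvalues i + r * hZ.1.eigenvalues j) : ℝ) : ℂ) *
        eigenConj hZ.1 A i j
    refine ⟨(hZ.1.eigenvectorUnitary : Matrix N N ℂ) * M *
      star (hZ.1.eigenvectorUnitary : Matrix N N ℂ), ?_⟩
    rw [← kernelQuad_left hZ.1, ← kernelQuad_right hZ.1]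
    simp only [kernelQuad, Finset.mul_sum, ← Finset.sum_add_distrib, eigenConj_sub,
      eigenConj_mul_mul_star]
    exact Finset.sum_congr rfl fun i _ => Finset.sum_congr rfl fun j _ =>
      parallelSum_mul_normSq_eq hr (hZ.eigenvalues_nonneg i) (hZ.eigenvalues_nonneg j) _
  rw [hB, hZe]
  have h1 := mul_le_mul_of_nonneg_left (upper hX B) ht0
  have h2 := mul_le_mul_of_nonneg_left (upper hY B) (sub_nonneg.2 ht1)
  simp only [add_mul, mul_add, Matrix.smul_mul, Matrix.mul_smul, Matrix.trace_add,
    Matrix.trace_smul, Complex.add_re, Complex.smul_re, smul_eq_mul] at h1 h2 ⊢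
  linarith

/-- Lieb's concavity theorem for the exponents `s` and `1 - s`. -/
lemma concaveKernel_rpow {s : ℝ} (hs : s ∈ Set.Ioo (0 : ℝ) 1) :
    ConcaveKernel N (fun x y => x ^ s * y ^ (1 - s)) := by
  have hint (x y : ℝ) (hx : 0 ≤ x) (hy : 0 ≤ y) :
      IntegrableOn (fun r : ℝ => r ^ (s - 1) * (x * y / (x + r * y))) (Set.Ioi 0) ∧
      ∫ r in Set.Ioi (0 : ℝ), r ^ (s - 1) * (x * y / (x + r * y)) =
        (∫ r in Set.Ioi (0 : ℝ), Real.rpowIntegrand₀₁ s r 1) * (x ^ s * y ^ (1 - s)) := by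
    rcases hy.eq_or_lt with rfl | hy
    · simp [Real.zero_rpow (sub_pos.2 hs.2).ne']
    · have hxy : 0 ≤ x / y := div_nonneg hx hy.le
      have e : Set.EqOn (fun r : ℝ => y * Real.rpowIntegrand₀₁ s r (x / y))
          (fun r : ℝ => r ^ (s - 1) * (x * y / (x + r * y))) (Set.Ioi 0) := by
        intro r hr
        have hr : 0 < r := hr
        have : 0 < x + r * y := by positivity
        simp only [Real.rpowIntegrand₀₁_eq_pow_div hs hr.le hxy]
        have e2 : r + x / y = (x + r * y) / y := by field_simp; ring
        rw [e2]
        field_simp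
      refine ⟨IntegrableOn.congr_fun ((Real.integrableOn_rpowIntegrand₀₁_Ioi hs hxy).const_mul y) e
        measurableSet_Ioi, ?_⟩
      rw [← setIntegral_congr_fun measurableSet_Ioi e, integral_const_mul,
        Real.integral_rpowIntegrand₀₁_eq_rpow_mul_const hs hxy, Real.div_rpow hx hy.le,
        Real.rpow_sub hy, Real.rpow_one]
      field_simp
  have hpos := Real.integral_rpowIntegrand₀₁_one_pos hs
  have hconc : ConcaveKernel N (fun x y =>
      ∫ r in Set.Ioi (0 : ℝ), r ^ (s - 1) * (x * y / (x + r * y))) := by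
    refine ConcaveKernel.integral ?_ fun x y hx hy => (hint x y hx hy).1
    filter_upwards [ae_restrict_mem measurableSet_Ioi] with r hr
    exact (concaveKernel_parallelSum hr).const_mul (Real.rpow_nonneg (le_of_lt hr) _)
  refine (hconc.const_mul (inv_nonneg.2 hpos.le)).congr fun x y hx hy => ?_
  rw [(hint x y hx hy).2, inv_mul_cancel_left₀ hpos.ne']

lemma integrable_exp_mul_rpow_mul_rpow (α : ℝ) {x y : ℝ} (hx : 0 ≤ x) (hy : 0 ≤ y) :
    IntegrableOn (fun s : ℝ => Real.exp (α * (s - 1 / 2)) * (x ^ s * y ^ (1 - s)))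
      (Set.Ioc 0 1) := by
  refine Integrable.bdd_mul (c := Real.exp |α|) ?_ ?_ ?_
  · refine Measure.integrableOn_of_bounded (M := (1 + x) * (1 + y)) (by simp) ?_ ?_
    · exact ((measurable_const.pow measurable_id).mul
        (measurable_const.pow (measurable_const.sub measurable_id))).aestronglyMeasurable
    · filter_upwards [ae_restrict_mem measurableSet_Ioc] with s hs
      have key {z p : ℝ} (hz : 0 ≤ z) (h0 : 0 ≤ p) (h1 : p ≤ 1) : z ^ p ≤ 1 + z :=
        calc z ^ p ≤ (1 + z) ^ p := Real.rpow_le_rpow hz (by linarith) h0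
          _ ≤ (1 + z) ^ (1 : ℝ) := Real.rpow_le_rpow_of_exponent_le (by linarith) h1
          _ = 1 + z := Real.rpow_one _
      rw [Real.norm_of_nonneg (by positivity)]
      exact mul_le_mul (key hx hs.1.le hs.2)
        (key hy (by linarith [hs.2]) (by linarith [hs.1])) (by positivity) (by positivity)
  · exact (by fun_prop : Continuous fun s : ℝ =>
      Real.exp (α * (s - 1 / 2))).aestronglyMeasurable
  · filter_upwards [ae_restrict_mem measurableSet_Ioc] with s hs
    rw [Real.norm_of_nonneg (Real.exp_pos _).le, Real.exp_le_exp]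
    refine (le_abs_self _).trans ?_
    rw [abs_mul]
    refine mul_le_of_le_one_right (abs_nonneg _) (abs_le.2 ⟨?_, ?_⟩) <;> linarith [hs.1, hs.2]

/-- The kernel of `[X]_α`: in the eigenbasis of `X` the operator multiplies the `(i, j)` entry
by `sandwichKernel α x_i x_j`. -/
noncomputable def sandwichKernel (α x y : ℝ) : ℝ :=
  ∫ s in Set.Ioc (0 : ℝ) 1, Real.exp (α * (s - 1 / 2)) * (x ^ s * y ^ (1 - s))

lemma concaveKernel_sandwichKernel (α : ℝ) : ConcaveKernel N (sandwichKernel α) := by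
  refine ConcaveKernel.integral ?_ fun x y hx hy => integrable_exp_mul_rpow_mul_rpow α hx hy
  rw [← Measure.restrict_congr_set Ioo_ae_eq_Ioc]
  filter_upwards [ae_restrict_mem measurableSet_Ioo] with s hs
  exact (concaveKernel_rpow hs).const_mul (Real.exp_pos _).le

end ConcaveKernel

section Sandwich

variable {N : Type*} [Fintype N] [DecidableEq N] {X : Matrix N N ℂ}

lemma sandwich_eq_eigenvectorUnitary_mul (hX : X.PosSemidef) (α : ℝ) (A : Matrix N N ℂ) :
    sandwich X α A = (hX.1.eigenvectorUnitary : Matrix N N ℂ) *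
      (Matrix.of fun i j =>
        (sandwichKernel α (hX.1.eigenvalues i) (hX.1.eigenvalues j) : ℂ) *
          eigenConj hX.1 A i j) * star (hX.1.eigenvectorUnitary : Matrix N N ℂ) := by
  set U := (hX.1.eigenvectorUnitary : Matrix N N ℂ)
  have hpow (s : ℝ) : mpow X s * A * mpow X (1 - s) = U * (Matrix.of fun i j =>
      (((hX.1.eigenvalues i ^ s * hX.1.eigenvalues j ^ (1 - s) : ℝ) : ℂ) *
        eigenConj hX.1 A i j)) * star U := by
    rw [← eigenvectorUnitary_mul_eigenConj_mul_star hX.1 (mpow X s * A * mpow X (1 - s)),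
      eigenConj_mul, eigenConj_mul, eigenConj_mpow, eigenConj_mpow]
    congr 2
    ext i j
    simp only [Matrix.mul_diagonal, Matrix.diagonal_mul, Matrix.of_apply]
    push_cast
    ring
  ext i k
  simp only [sandwich, Matrix.of_apply, hpow]
  rw [intervalIntegral.integral_of_le zero_le_one]
  have hexp (s : ℝ) : Real.exp (α * (s - 1 / 2)) • (U * (Matrix.of fun i j =>
      (((hX.1.eigenvalues i ^ s * hX.1.eigenvalues j ^ (1 - s) : ℝ) : ℂ) *
        eigenConj hX.1 A i j)) * star U) i k =
      ∑ q, ∑ p, ((Real.exp (α * (s - 1 / 2)) *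
        (hX.1.eigenvalues p ^ s * hX.1.eigenvalues q ^ (1 - s)) : ℝ) : ℂ) *
          (U i p * eigenConj hX.1 A p q * star U q k) := by
    simp only [Matrix.mul_apply, Matrix.of_apply, Complex.real_smul, Finset.sum_mul,
      Finset.mul_sum]
    refine Finset.sum_congr rfl fun q _ => Finset.sum_congr rfl fun p _ => ?_
    push_cast
    ring
  have hint (p q : N) : IntegrableOn (fun s : ℝ => ((Real.exp (α * (s - 1 / 2)) *
        (hX.1.eigenvalues p ^ s * hX.1.eigenvalues q ^ (1 - s)) : ℝ) : ℂ) *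
          (U i p * eigenConj hX.1 A p q * star U q k)) (Set.Ioc 0 1) :=
    (integrable_exp_mul_rpow_mul_rpow α (hX.eigenvalues_nonneg p)
      (hX.eigenvalues_nonneg q)).ofReal.mul_const _
  simp only [hexp]
  rw [integral_finsetSum _ fun q _ => integrable_finsetSum _ fun p _ => hint p q]
  simp only [Matrix.mul_apply, Matrix.of_apply, Finset.sum_mul]
  refine Finset.sum_congr rfl fun q _ => ?_
  rw [integral_finsetSum _ fun p _ => hint p q]
  refine Finset.sum_congr rfl fun p _ => ?_
  rw [integral_mul_const, integral_complex_ofReal, sandwichKernel]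
  ring

lemma gns_sandwich_left (hX : X.PosSemidef) (α : ℝ) (A B : Matrix N N ℂ) :
    gns (sandwich X α A) B = gns A (sandwich X α B) := by
  rw [gns_eq_sum_eigenConj hX.1, gns_eq_sum_eigenConj hX.1,
    sandwich_eq_eigenvectorUnitary_mul hX, sandwich_eq_eigenvectorUnitary_mul hX,
    eigenConj_mul_mul_star, eigenConj_mul_mul_star]
  congr 1
  refine Finset.sum_congr rfl fun i _ => Finset.sum_congr rfl fun j _ => ?_
  simp
  ring

lemma gns_sandwich_self_re (hX : X.PosSemidef) (α : ℝ) (A : Matrix N N ℂ) :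
    (gns A (sandwich X α A)).re =
      kernelQuad hX.1 (sandwichKernel α) A / Fintype.card N := by
  rw [gns_eq_sum_eigenConj hX.1, sandwich_eq_eigenvectorUnitary_mul hX, eigenConj_mul_mul_star,
    Complex.div_natCast_re, kernelQuad]
  simp only [Complex.re_sum]
  congr 1
  refine Finset.sum_congr rfl fun i _ => Finset.sum_congr rfl fun j _ => ?_
  simp [Complex.normSq_apply]
  ring

end Sandwich

lemma gns_sub_smul_add_smul_left {N : Type*} [Fintype N] (A₁ A₂ A₃ B : Matrix N N ℂ) (a b : ℝ) :
    gns (A₁ - (a • A₂ + b • A₃)) B = gns A₁ B - (a * gns A₂ B + b * gns A₃ B) := by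
  simp only [gns, tau, Matrix.conjTranspose_sub, Matrix.conjTranspose_add,
    Matrix.conjTranspose_smul, sub_mul, add_mul, Matrix.smul_mul, Matrix.trace_sub,
    Matrix.trace_add, Matrix.trace_smul, star_trivial, Complex.real_smul]
  ring

lemma gns_sub_smul_add_smul_right {N : Type*} [Fintype N] (A B₁ B₂ B₃ : Matrix N N ℂ)
    (a b : ℝ) :
    gns A (B₁ - (a • B₂ + b • B₃)) = gns A B₁ - (a * gns A B₂ + b * gns A B₃) := by
  simp only [gns, tau, mul_sub, mul_add, Matrix.mul_smul, Matrix.trace_sub,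
    Matrix.trace_add, Matrix.trace_smul, Complex.real_smul]
  ring

/-- **Concavity of `X ↦ [X]_α`** ([KA80, Theorem 3.5]): for positive semidefinite `X, Y`
and `t ∈ [0,1]`, `[tX + (1-t)Y]_α ≥ t[X]_α + (1-t)[Y]_α` in the Loewner order on
operators on `(M_n(ℂ), ⟨·,·⟩)`. -/
theorem sandwich_concave {N : Type*} [Fintype N] [DecidableEq N] (α : ℝ)
    (X Y : Matrix N N ℂ) (hX : X.PosSemidef) (hY : Y.PosSemidef)
    (t : ℝ) (ht0 : 0 ≤ t) (ht1 : t ≤ 1) :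
    OpPosSemidef (fun A =>
      sandwich (t • X + (1 - t) • Y) α A
        - (t • sandwich X α A + (1 - t) • sandwich Y α A)) := by
  have hZ : (t • X + (1 - t) • Y).PosSemidef := (hX.smul ht0).add (hY.smul (sub_nonneg.2 ht1))
  refine ⟨fun A B => ?_, fun A => ?_⟩
  · simp only [gns_sub_smul_add_smul_left, gns_sub_smul_add_smul_right, gns_sandwich_left hX,
      gns_sandwich_left hY, gns_sandwich_left hZ]
  · simp only [gns_sub_smul_add_smul_right, Complex.sub_re, Complex.add_re,
      Complex.re_ofReal_mul, gns_sandwich_self_re hX, gns_sandwich_self_re hY,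
      gns_sandwich_self_re hZ]
    have h := div_le_div_of_nonneg_right
      (concaveKernel_sandwichKernel α X Y _ hX hY hZ t ht0 ht1 rfl A)
      (Nat.cast_nonneg (α := ℝ) (Fintype.card N))
    rw [add_div, mul_div_assoc, mul_div_assoc] at h
    exact sub_nonneg.2 h
end

section
/- Fix α ∈ ℝ. The map X ↦ [X]_α is operator monotone on positive semidefinite matrices: if X, Y ∈ M_n(ℂ) are positive semidefinite with X ≤ Y (Loewner order on matrices), then [X]_α ≤ [Y]_α as operators on the Hilbert space (M_n(ℂ), ⟨·,·⟩). In particular, if ρ ≥ λ·I with λ > 0, then ⟨V, [ρ]_α⁻¹V⟩ ≤ ⟨V, [λI]_α⁻¹V⟩ for every V ∈ M_n(ℂ). -/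
open MeasureTheory Matrix
open scoped ENNReal Classical ComplexOrder

/-- Extended value `⟨V, K⁻¹ V⟩ ∈ [0,∞]` for a positive operator `K` on
`(M_n(ℂ), ⟨·,·⟩)`: equals `⟨W, K W⟩` if `V = K W` with `W ⊥ ker K`, and `+∞` otherwise. -/
noncomputable def invQuadM {N : Type*} [Fintype N]
    (K : Matrix N N ℂ → Matrix N N ℂ) (V : Matrix N N ℂ) : ℝ≥0∞ :=
  if h : ∃ W, K W = V ∧ ∀ U, K U = 0 → gns W U = 0
  then ENNReal.ofReal (gns h.choose (K h.choose)).re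
  else ⊤

open scoped ComplexConjugate

section Gns

variable {N : Type*} [Fintype N]

lemma gns_eq_sum (A B : Matrix N N ℂ) :
    gns A B = ∑ i, ∑ j, (conj (A j i) / (Fintype.card N : ℂ)) * B j i := by
  simp only [gns, tau, Matrix.trace, Matrix.diag, Matrix.mul_apply, Matrix.conjTranspose_apply,
    Finset.sum_div]
  refine Finset.sum_congr rfl fun i _ => Finset.sum_congr rfl fun j _ => ?_
  simp only [starRingEnd_apply]
  ring

lemma conj_gns (A B : Matrix N N ℂ) : conj (gns A B) = gns B A := by
  have h : (Bᴴ * A).trace = conj (Aᴴ * B).trace := by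
    rw [starRingEnd_apply, ← Matrix.trace_conjTranspose, Matrix.conjTranspose_mul,
      Matrix.conjTranspose_conjTranspose]
  simp [gns, tau, h]

lemma gns_sub_right (A B C : Matrix N N ℂ) : gns A (B - C) = gns A B - gns A C := by
  simp [gns, tau, Matrix.mul_sub, Matrix.trace_sub, sub_div]

lemma gns_sub_left (A B C : Matrix N N ℂ) : gns (A - B) C = gns A C - gns B C := by
  simp [gns, tau, Matrix.sub_mul, Matrix.trace_sub, sub_div]

lemma gns_re_comm (A B : Matrix N N ℂ) : (gns A B).re = (gns B A).re := by
  rw [← conj_gns B A, Complex.conj_re]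

lemma gns_self_re_nonneg (A : Matrix N N ℂ) : 0 ≤ (gns A A).re := by
  have h := (Complex.nonneg_iff.mp (Matrix.posSemidef_conjTranspose_mul_self A).trace_nonneg).1
  rw [gns, tau, Complex.div_natCast_re]
  positivity

lemma gns_self_re_eq_zero {A : Matrix N N ℂ} (hA : (gns A A).re = 0) : A = 0 := by
  rcases isEmpty_or_nonempty N with hN | hN
  · exact Subsingleton.elim _ _
  · have h := Complex.nonneg_iff.mp (Matrix.posSemidef_conjTranspose_mul_self A).trace_nonneg
    rw [gns, tau, Complex.div_natCast_re, div_eq_zero_iff] at hA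
    have hcard : (Fintype.card N : ℝ) ≠ 0 := by positivity
    rw [← Matrix.trace_conjTranspose_mul_self_eq_zero_iff]
    exact Complex.ext (hA.resolve_right hcard) h.2.symm

end Gns

section Mpow

variable {N : Type*} [Fintype N] [DecidableEq N]

lemma mpow_eq_cfc {X : Matrix N N ℂ} (hX : X.IsHermitian) (s : ℝ) :
    mpow X s = cfc (fun x : ℝ => x ^ s) X := by
  rw [hX.cfc_eq, mpow, dif_pos hX, Matrix.IsHermitian.cfc, Unitary.conjStarAlgAut_apply]
  rfl

lemma conjTranspose_mpow (X : Matrix N N ℂ) (s : ℝ) : (mpow X s)ᴴ = mpow X s := by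
  by_cases hX : X.IsHermitian
  · rw [mpow_eq_cfc hX]
    exact cfc_predicate (fun x : ℝ => x ^ s) X
  · simp [mpow, hX]

lemma posSemidef_mpow {X : Matrix N N ℂ} (hX : X.PosSemidef) (s : ℝ) :
    (mpow X s).PosSemidef := by
  rw [mpow, dif_pos hX.isHermitian]
  refine Matrix.PosSemidef.mul_mul_conjTranspose_same (Matrix.PosSemidef.diagonal fun i => ?_) _
  exact Complex.zero_le_real.mpr (Real.rpow_nonneg (hX.eigenvalues_nonneg i) s)

open scoped MatrixOrder Matrix.Norms.L2Operator in
/-- The Löwner–Heinz inequality for matrix powers. -/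
lemma posSemidef_mpow_sub_mpow {X Y : Matrix N N ℂ} (hX : X.PosSemidef) (hY : Y.PosSemidef)
    (hXY : (Y - X).PosSemidef) {s : ℝ} (hs : s ∈ Set.Icc (0 : ℝ) 1) :
    (mpow Y s - mpow X s).PosSemidef := by
  have h : X ^ s ≤ Y ^ s := CFC.monotone_rpow hs (Matrix.le_iff.mpr hXY)
  rw [CFC.rpow_eq_cfc_real (Matrix.nonneg_iff_posSemidef.mpr hX),
    CFC.rpow_eq_cfc_real (Matrix.nonneg_iff_posSemidef.mpr hY)] at h
  rw [mpow_eq_cfc hX.isHermitian, mpow_eq_cfc hY.isHermitian]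
  exact Matrix.le_iff.mp h

lemma mpow_smul_one (c s : ℝ) :
    mpow (c • (1 : Matrix N N ℂ)) s = (c ^ s : ℝ) • (1 : Matrix N N ℂ) := by
  have hc : (c • (1 : Matrix N N ℂ)).IsHermitian := by
    simp [Matrix.IsHermitian, Matrix.conjTranspose_smul]
  rw [mpow_eq_cfc hc, ← Algebra.algebraMap_eq_smul_one, cfc_algebraMap,
    Algebra.algebraMap_eq_smul_one]

open scoped MatrixOrder in
lemma trace_mul_nonneg_of_posSemidef {P Q : Matrix N N ℂ} (hP : P.PosSemidef)
    (hQ : Q.PosSemidef) : 0 ≤ (P * Q).trace := by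
  obtain ⟨B, rfl⟩ := CStarAlgebra.nonneg_iff_eq_star_mul_self.mp hQ.nonneg
  rw [← Matrix.mul_assoc, Matrix.trace_mul_comm, ← Matrix.mul_assoc]
  exact (hP.mul_mul_conjTranspose_same B).trace_nonneg

lemma gns_mpow_mul_mul_mpow_symm (X A B : Matrix N N ℂ) (s t : ℝ) :
    gns (mpow X s * A * mpow X t) B = gns A (mpow X s * B * mpow X t) := by
  simp only [gns, tau, Matrix.conjTranspose_mul, conjTranspose_mpow]
  rw [Matrix.mul_assoc, Matrix.trace_mul_comm]
  simp only [Matrix.mul_assoc]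

lemma gns_mpow_mul_mul_mpow_mono {X Y : Matrix N N ℂ} (hX : X.PosSemidef) (hY : Y.PosSemidef)
    (hXY : (Y - X).PosSemidef) (A : Matrix N N ℂ) {s t : ℝ} (hs : s ∈ Set.Icc (0 : ℝ) 1)
    (ht : t ∈ Set.Icc (0 : ℝ) 1) :
    (gns A (mpow X s * A * mpow X t)).re ≤ (gns A (mpow Y s * A * mpow Y t)).re := by
  have h₁ := trace_mul_nonneg_of_posSemidef
    ((posSemidef_mpow_sub_mpow hX hY hXY hs).conjTranspose_mul_mul_same A) (posSemidef_mpow hY t)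
  have h₂ := trace_mul_nonneg_of_posSemidef
    ((posSemidef_mpow hX s).conjTranspose_mul_mul_same A) (posSemidef_mpow_sub_mpow hX hY hXY ht)
  have h := (Complex.nonneg_iff.mp (add_nonneg h₁ h₂)).1
  have key : (Aᴴ * (mpow Y s - mpow X s) * A * mpow Y t).trace +
      (Aᴴ * mpow X s * A * (mpow Y t - mpow X t)).trace =
      (Aᴴ * (mpow Y s * A * mpow Y t)).trace - (Aᴴ * (mpow X s * A * mpow X t)).trace := by
    rw [← Matrix.trace_add, ← Matrix.trace_sub]
    congr 1
    noncomm_ring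
  rw [key, Complex.sub_re, sub_nonneg] at h
  simp only [gns, tau, Complex.div_natCast_re]
  gcongr

end Mpow

section Sandwich

variable {N : Type*} [Fintype N] [DecidableEq N]

lemma rpow_le_one_add {x s : ℝ} (hx : 0 ≤ x) (hs : s ∈ Set.Icc (0 : ℝ) 1) : x ^ s ≤ 1 + x := by
  rcases le_total x 1 with h | h
  · exact (Real.rpow_le_one hx h hs.1).trans (by linarith)
  · exact (Real.rpow_le_rpow_of_exponent_le h hs.2).trans (by rw [Real.rpow_one]; linarith)

lemma intervalIntegrable_rpow_mul_rpow {x y : ℝ} (hx : 0 ≤ x) (hy : 0 ≤ y) :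
    IntervalIntegrable (fun s : ℝ => ((x ^ s * y ^ (1 - s) : ℝ) : ℂ)) volume 0 1 := by
  rw [intervalIntegrable_iff_integrableOn_Ioc_of_le zero_le_one]
  refine Measure.integrableOn_of_bounded (M := (1 + x) * (1 + y)) (by simp)
    (Measurable.aestronglyMeasurable (by fun_prop)) ?_
  filter_upwards [ae_restrict_mem measurableSet_Ioc] with s hs
  have hxs := Real.rpow_nonneg hx s
  have hys := Real.rpow_nonneg hy (1 - s)
  rw [Complex.norm_real, Real.norm_of_nonneg (mul_nonneg hxs hys)]
  exact mul_le_mul (rpow_le_one_add hx ⟨hs.1.le, hs.2⟩)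
    (rpow_le_one_add hy ⟨by linarith [hs.2], by linarith [hs.1]⟩) hys (by positivity)

lemma intervalIntegrable_sum_sum {ι : Type*} [Fintype ι] {f : ι → ι → ℝ → ℂ} {a b : ℝ}
    (hf : ∀ i j, IntervalIntegrable (f i j) volume a b) :
    IntervalIntegrable (fun s => ∑ i, ∑ j, f i j s) volume a b :=
  ⟨integrable_finsetSum _ fun i _ => integrable_finsetSum _ fun j _ => (hf i j).1,
    integrable_finsetSum _ fun i _ => integrable_finsetSum _ fun j _ => (hf i j).2⟩

lemma intervalIntegrable_sandwich {X : Matrix N N ℂ} (hX : X.PosSemidef) (α : ℝ)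
    (A : Matrix N N ℂ) (i k : N) :
    IntervalIntegrable (fun s : ℝ => Real.exp (α * (s - 1 / 2)) •
      ((mpow X s * A * mpow X (1 - s)) i k)) volume 0 1 := by
  refine IntervalIntegrable.continuousOn_smul ?_ (by fun_prop)
  set U : Matrix N N ℂ := ↑hX.isHermitian.eigenvectorUnitary with hU
  have hentry : ∀ s : ℝ, (mpow X s * A * mpow X (1 - s)) i k =
      ∑ l, ∑ j, (U i j * (star U * A * U) j l * star U l k) *
        ((hX.isHermitian.eigenvalues j ^ s *
          hX.isHermitian.eigenvalues l ^ (1 - s) : ℝ) : ℂ) := by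
    intro s
    have hfactor : mpow X s * A * mpow X (1 - s) =
        U * (diagonal (fun i => ((hX.isHermitian.eigenvalues i ^ s : ℝ) : ℂ)) *
          (star U * A * U) *
          diagonal (fun i => ((hX.isHermitian.eigenvalues i ^ (1 - s) : ℝ) : ℂ))) * star U := by
      simp only [mpow, dif_pos hX.isHermitian, ← hU, Matrix.mul_assoc]
    rw [hfactor, Matrix.mul_apply]
    refine Finset.sum_congr rfl fun l _ => ?_
    rw [Matrix.mul_apply, Finset.sum_mul]
    refine Finset.sum_congr rfl fun j _ => ?_
    rw [Matrix.mul_diagonal, Matrix.diagonal_mul]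
    push_cast
    ring
  simp only [hentry]
  exact intervalIntegrable_sum_sum fun l j =>
    (intervalIntegrable_rpow_mul_rpow (hX.eigenvalues_nonneg j)
      (hX.eigenvalues_nonneg l)).const_mul _

lemma gns_smul_mpow_eq_sum (X A B : Matrix N N ℂ) (α s : ℝ) :
    Real.exp (α * (s - 1 / 2)) • gns A (mpow X s * B * mpow X (1 - s)) =
      ∑ i, ∑ j, (conj (A j i) / (Fintype.card N : ℂ)) *
        (Real.exp (α * (s - 1 / 2)) • (mpow X s * B * mpow X (1 - s)) j i) := by
  simp only [gns_eq_sum, Finset.smul_sum, mul_smul_comm]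

lemma intervalIntegrable_gns {X : Matrix N N ℂ} (hX : X.PosSemidef) (α : ℝ)
    (A B : Matrix N N ℂ) :
    IntervalIntegrable (fun s : ℝ => Real.exp (α * (s - 1 / 2)) •
      gns A (mpow X s * B * mpow X (1 - s))) volume 0 1 := by
  simp only [gns_smul_mpow_eq_sum]
  exact intervalIntegrable_sum_sum fun i j =>
    (intervalIntegrable_sandwich hX α B j i).const_mul _

lemma gns_sandwich {X : Matrix N N ℂ} (hX : X.PosSemidef) (α : ℝ) (A B : Matrix N N ℂ) :
    gns A (sandwich X α B) = ∫ s in (0 : ℝ)..1, Real.exp (α * (s - 1 / 2)) •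
      gns A (mpow X s * B * mpow X (1 - s)) := by
  have hint := fun i j => (intervalIntegrable_sandwich hX α B j i).const_mul
    (conj (A j i) / (Fintype.card N : ℂ))
  simp only [gns_smul_mpow_eq_sum]
  rw [intervalIntegral.integral_finsetSum fun i _ =>
    ⟨integrable_finsetSum _ fun j _ => (hint i j).1,
      integrable_finsetSum _ fun j _ => (hint i j).2⟩, gns_eq_sum]
  refine Finset.sum_congr rfl fun i _ => ?_
  rw [intervalIntegral.integral_finsetSum fun j _ => hint i j]
  refine Finset.sum_congr rfl fun j _ => ?_
  rw [intervalIntegral.integral_const_mul]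
  rfl

lemma gns_sandwich_symm {X : Matrix N N ℂ} (hX : X.PosSemidef) (α : ℝ) (A B : Matrix N N ℂ) :
    gns (sandwich X α A) B = gns A (sandwich X α B) := by
  rw [← conj_gns, gns_sandwich hX, gns_sandwich hX, ← intervalIntegral.intervalIntegral_conj]
  refine intervalIntegral.integral_congr fun s _ => ?_
  simp only [Complex.real_smul, map_mul, Complex.conj_ofReal, conj_gns,
    gns_mpow_mul_mul_mpow_symm]

lemma re_gns_sandwich {X : Matrix N N ℂ} (hX : X.PosSemidef) (α : ℝ) (A B : Matrix N N ℂ) :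
    (gns A (sandwich X α B)).re = ∫ s in (0 : ℝ)..1, Real.exp (α * (s - 1 / 2)) *
      (gns A (mpow X s * B * mpow X (1 - s))).re := by
  rw [gns_sandwich hX, ← Complex.reCLM_apply,
    ← Complex.reCLM.intervalIntegral_comp_comm (intervalIntegrable_gns hX α A B)]
  simp only [Complex.reCLM_apply, Complex.smul_re, smul_eq_mul]

lemma intervalIntegrable_re_gns {X : Matrix N N ℂ} (hX : X.PosSemidef) (α : ℝ)
    (A B : Matrix N N ℂ) :
    IntervalIntegrable (fun s : ℝ => Real.exp (α * (s - 1 / 2)) *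
      (gns A (mpow X s * B * mpow X (1 - s))).re) volume 0 1 := by
  have h := intervalIntegrable_gns hX α A B
  rw [intervalIntegrable_iff, IntegrableOn] at h ⊢
  simpa only [RCLike.re_eq_complex_re, Complex.smul_re, smul_eq_mul] using Integrable.re h

lemma re_gns_sandwich_mono {X Y : Matrix N N ℂ} (hX : X.PosSemidef) (hY : Y.PosSemidef)
    (hXY : (Y - X).PosSemidef) (α : ℝ) (A : Matrix N N ℂ) :
    (gns A (sandwich X α A)).re ≤ (gns A (sandwich Y α A)).re := by
  rw [re_gns_sandwich hX, re_gns_sandwich hY]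
  refine intervalIntegral.integral_mono_on zero_le_one (intervalIntegrable_re_gns hX α A A)
    (intervalIntegrable_re_gns hY α A A) fun s hs => ?_
  have h := gns_mpow_mul_mul_mpow_mono hX hY hXY A hs (t := 1 - s)
    ⟨by linarith [hs.2], by linarith [hs.1]⟩
  gcongr

/-- The map `A ↦ [X]_α(A)` for positive semidefinite `X`, as a linear map. -/
noncomputable def sandwichLinearMap {X : Matrix N N ℂ} (hX : X.PosSemidef) (α : ℝ) :
    Matrix N N ℂ →ₗ[ℂ] Matrix N N ℂ where
  toFun := sandwich X α
  map_add' A B := by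
    ext i k
    simp only [sandwich, Matrix.of_apply, Matrix.add_apply]
    rw [← intervalIntegral.integral_add (intervalIntegrable_sandwich hX α A i k)
      (intervalIntegrable_sandwich hX α B i k)]
    simp only [Matrix.mul_add, Matrix.add_mul, Matrix.add_apply, smul_add]
  map_smul' c A := by
    ext i k
    simp only [sandwich, Matrix.of_apply, Matrix.smul_apply, RingHom.id_apply]
    rw [← intervalIntegral.integral_smul]
    simp only [Matrix.mul_smul, Matrix.smul_mul, Matrix.smul_apply,
      smul_comm c (Real.exp _)]

lemma sandwich_smul_one {c : ℝ} (hc : 0 < c) (α : ℝ) (A : Matrix N N ℂ) :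
    sandwich (c • (1 : Matrix N N ℂ)) α A =
      ((∫ s in (0 : ℝ)..1, Real.exp (α * (s - 1 / 2))) * c) • A := by
  ext i k
  simp only [sandwich, Matrix.of_apply, mpow_smul_one, Matrix.smul_mul, Matrix.mul_smul,
    Matrix.one_mul, Matrix.mul_one, Matrix.smul_apply, smul_smul]
  rw [intervalIntegral.integral_smul_const, ← intervalIntegral.integral_mul_const]
  congr 1
  refine intervalIntegral.integral_congr fun s _ => ?_
  have h : c ^ s * c ^ (1 - s) = c := by rw [← Real.rpow_add hc]; simp
  linear_combination Real.exp (α * (s - 1 / 2)) * h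

end Sandwich

section InvQuad

variable {N : Type*} [Fintype N]

lemma gns_smul_right (c : ℝ) (A B : Matrix N N ℂ) : (gns A (c • B)).re = c * (gns A B).re := by
  simp [gns, tau, Matrix.trace_smul, mul_div_assoc]

/-- The quadratic form of the inverse is antitone, with a positive multiple of the identity as
the smaller operator. -/
lemma invQuadM_le_of_smul_le (K : Matrix N N ℂ →ₗ[ℂ] Matrix N N ℂ) {m : ℝ} (hm : 0 < m)
    (hK : ∀ A, m * (gns A A).re ≤ (gns A (K A)).re) (V : Matrix N N ℂ) :
    invQuadM K V ≤ invQuadM (fun A => m • A) V := by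
  have hker : ∀ U, K U = 0 → U = 0 := fun U hU => by
    have h := hK U
    have h0 := gns_self_re_nonneg U
    rw [hU, show (gns U 0).re = 0 by simp [gns, tau]] at h
    exact gns_self_re_eq_zero (le_antisymm (by nlinarith) h0)
  have hinj : Function.Injective K := (injective_iff_map_eq_zero K).mpr hker
  have hW : ∃ W, K W = V ∧ ∀ U, K U = 0 → gns W U = 0 := by
    obtain ⟨W, hW⟩ := LinearMap.injective_iff_surjective.mp hinj V
    exact ⟨W, hW, fun U hU => by simp [hker U hU, gns, tau]⟩
  rw [invQuadM, dif_pos hW, invQuadM]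
  split_ifs with hW'
  · refine ENNReal.ofReal_le_ofReal ?_
    have hKW := hW.choose_spec.1
    have hmW := hW'.choose_spec.1
    generalize hW.choose = W at hKW
    generalize hW'.choose = W' at hmW
    have h := mul_nonneg hm.le (gns_self_re_nonneg (W - W'))
    simp only [gns_sub_left, gns_sub_right, Complex.sub_re, gns_re_comm W' W] at h
    have hV : (gns W (K W)).re = m * (gns W W').re := by rw [hKW, ← hmW, gns_smul_right]
    have hWW := hK W
    rw [gns_smul_right]
    linarith
  · exact le_top

end InvQuad

/-- **Operator monotonicity of `X ↦ [X]_α`**: if `X ≤ Y` (Loewner order on matrices) with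
`X, Y` positive semidefinite, then `[X]_α ≤ [Y]_α` as operators on `(M_n(ℂ), ⟨·,·⟩)`; in
particular, if `ρ ≥ λ·I` with `λ > 0` then `⟨V, [ρ]_α⁻¹ V⟩ ≤ ⟨V, [λI]_α⁻¹ V⟩` for all `V`. -/
theorem sandwich_monotone {N : Type*} [Fintype N] [DecidableEq N] (α : ℝ) :
    (∀ X Y : Matrix N N ℂ, X.PosSemidef → Y.PosSemidef → (Y - X).PosSemidef →
      OpPosSemidef (fun A => sandwich Y α A - sandwich X α A)) ∧
    (∀ (lam : ℝ), 0 < lam → ∀ ρ : Matrix N N ℂ,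
      (ρ - lam • (1 : Matrix N N ℂ)).PosSemidef →
        ∀ V : Matrix N N ℂ,
          invQuadM (sandwich ρ α) V ≤ invQuadM (sandwich (lam • 1) α) V) := by
  refine ⟨fun X Y hX hY hXY => ⟨fun A B => ?_, fun A => ?_⟩, fun lam hlam ρ hρ V => ?_⟩
  · rw [gns_sub_left, gns_sub_right, gns_sandwich_symm hX, gns_sandwich_symm hY]
  · rw [gns_sub_right, Complex.sub_re, sub_nonneg]
    exact re_gns_sandwich_mono hX hY hXY α A
  · have hone : (lam • (1 : Matrix N N ℂ)).PosSemidef := Matrix.PosSemidef.one.smul hlam.le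
    have hρ' : ρ.PosSemidef := by simpa using hρ.add hone
    have hm : 0 < (∫ s in (0 : ℝ)..1, Real.exp (α * (s - 1 / 2))) * lam :=
      mul_pos (intervalIntegral.intervalIntegral_pos_of_pos
        (Continuous.intervalIntegrable (by fun_prop) _ _) (fun s => Real.exp_pos _)
        zero_lt_one) hlam
    rw [show sandwich (lam • (1 : Matrix N N ℂ)) α = _ from funext (sandwich_smul_one hlam α)]
    refine invQuadM_le_of_smul_le (sandwichLinearMap hρ' α) hm (fun A => ?_) V
    rw [← gns_smul_right, ← sandwich_smul_one hlam α]
    exact re_gns_sandwich_mono hone hρ' hρ α A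
end
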